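/- arXiv:1811.05870 — 2 statements merged into one kernel-verified Lean document; each statement's English description precedes it below -/
import Mathlib

section
/- Let G be a group and let M be a G-graded Lie algebra over a field, V ⊆ M a graded ideal and L ⊆ M a graded subalgebra with M = V ⊕ L (so M is a semidirect product of V and L). Assume that the support of L is a commutative subset of G, and that, under the adjoint action, V is a faithful L-module generated by a single homogeneous element. Then the support of M is a commutative subset of G. -/
set_option synthInstance.maxHeartbeats 1000000
set_option maxHeartbeats 1000000

structure LieGrading (F : Type*) [CommRing F] (L : Type*) [LieRing L] [LieAlgebra F L]
    (G : Type*) [Group G] where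
  comp : G → Submodule F L
  indep : ∀ g : G, Disjoint (comp g) (⨆ h : G, ⨆ _ : h ≠ g, comp h)
  total : (⨆ g : G, comp g) = ⊤
  lie_mem : ∀ g h : G, ∀ x ∈ comp g, ∀ y ∈ comp h, ⁅x, y⁆ ∈ comp (g * h)

/-- A submodule `W` is a graded subspace. -/
def LieGrading.IsGradedSubspace {F : Type*} [CommRing F] {L : Type*} [LieRing L]
    [LieAlgebra F L] {G : Type*} [Group G] (Γ : LieGrading F L G) (W : Submodule F L) : Prop :=
  W = ⨆ g : G, W ⊓ Γ.comp g

/-- Elements of a subgroup generated by pairwise commuting elements commute. -/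
theorem Subgroup.mul_comm_of_mem_closure {G : Type*} [Group G] {S : Set G}
    (hS : ∀ a ∈ S, ∀ b ∈ S, a * b = b * a) {a b : G}
    (ha : a ∈ Subgroup.closure S) (hb : b ∈ Subgroup.closure S) : a * b = b * a := by
  have := Subgroup.isMulCommutative_closure hS
  exact congrArg Subtype.val (mul_comm' (⟨a, ha⟩ : Subgroup.closure S) ⟨b, hb⟩)

namespace LieGrading

variable {F : Type*} [CommRing F] {M : Type*} [LieRing M] [LieAlgebra F M] {G : Type*} [Group G]
  (Γ : LieGrading F M G)

/-- If homogeneous components with degrees in `T` span, then `T` contains the support. -/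
theorem mem_of_comp_ne_bot {T : Set G} (hT : (⨆ g ∈ T, Γ.comp g) = ⊤) {h : G}
    (hh : Γ.comp h ≠ ⊥) : h ∈ T := by
  by_contra hmem
  refine hh (disjoint_top.mp ((Γ.indep h).mono_right ?_))
  rw [← hT]
  refine iSup₂_le fun g hg => le_iSup₂_of_le g ?_ le_rfl
  rintro rfl
  exact hmem hg

/-- The degrees of homogeneous elements with nonzero bracket commute. -/
theorem mul_comm_of_lie_ne_zero {g h : G} {x y : M} (hx : x ∈ Γ.comp g) (hy : y ∈ Γ.comp h)
    (hxy : ⁅x, y⁆ ≠ 0) : g * h = h * g := by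
  by_contra hne
  have hyx : ⁅x, y⁆ ∈ Γ.comp (h * g) := by
    rw [← lie_skew]
    exact neg_mem (Γ.lie_mem h g y hy x hx)
  exact hxy (Submodule.disjoint_def.mp (Γ.indep (g * h)) _ (Γ.lie_mem g h x hx y hy)
    ((le_iSup₂_of_le (f := fun k (_ : k ≠ g * h) => Γ.comp k) (h * g) (Ne.symm hne) le_rfl) hyx))

/-- Let `L` be a graded subspace whose support lies in a subgroup `H`. The sum of the pieces of an
ideal `V` with degrees in the coset `H * g₀` is stable under bracketing with `L`. -/
theorem lie_mem_iSup_coset {V : LieIdeal F M} {L : Submodule F M} (hL : Γ.IsGradedSubspace L)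
    {H : Subgroup G} (hH : ∀ g, L ⊓ Γ.comp g ≠ ⊥ → g ∈ H) (g₀ : G) {x w : M} (hx : x ∈ L)
    (hw : w ∈ ⨆ k ∈ H, V.toSubmodule ⊓ Γ.comp (k * g₀)) :
    ⁅x, w⁆ ∈ ⨆ k ∈ H, V.toSubmodule ⊓ Γ.comp (k * g₀) := by
  set W := ⨆ k ∈ H, V.toSubmodule ⊓ Γ.comp (k * g₀)
  have key : W ≤ W.comap (LieAlgebra.ad F M x) := by
    refine iSup₂_le fun k hk y hy => ?_
    have hxy : L ≤ W.comap (LieAlgebra.ad F M y) := by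
      rw [hL]
      refine iSup_le fun g z hz => ?_
      rw [Submodule.mem_comap]
      change ⁅y, z⁆ ∈ W
      by_cases hz0 : z = 0
      · simp [hz0]
      have hg : g ∈ H := hH g (Submodule.ne_bot_iff _ |>.mpr ⟨z, hz, hz0⟩)
      rw [← lie_skew]
      refine neg_mem (Submodule.mem_iSup_of_mem (g * k)
        (Submodule.mem_iSup_of_mem (H.mul_mem hg hk) ⟨lie_mem_right F M V z y hy.1, ?_⟩))
      rw [mul_assoc]
      exact Γ.lie_mem g (k * g₀) z hz.2 y hy.2
    have := hxy hx
    rw [Submodule.mem_comap] at this ⊢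
    change ⁅y, x⁆ ∈ W at this
    change ⁅x, y⁆ ∈ W
    rw [← lie_skew]
    exact neg_mem this
  exact key hw

end LieGrading

theorem stmt15 {F : Type*} [Field F] {M : Type*} [LieRing M] [LieAlgebra F M]
    {G : Type*} [Group G] (Γ : LieGrading F M G)
    (V : LieIdeal F M) (L : LieSubalgebra F M)
    -- `M = V ⊕ L`:
    (hdisj : V.toSubmodule ⊓ L.toSubmodule = ⊥)
    (hsup : V.toSubmodule ⊔ L.toSubmodule = ⊤)
    -- `V` and `L` are graded:
    (hVgr : Γ.IsGradedSubspace V.toSubmodule)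
    (hLgr : Γ.IsGradedSubspace L.toSubmodule)
    -- the support of `L` is commutative:
    (hLsupp : ∀ g h : G, L.toSubmodule ⊓ Γ.comp g ≠ ⊥ → L.toSubmodule ⊓ Γ.comp h ≠ ⊥ →
      g * h = h * g)
    -- `V` is a faithful `L`-module (adjoint action):
    (hfaith : ∀ x ∈ L, (∀ v ∈ V, ⁅x, v⁆ = 0) → x = 0)
    -- `V` is generated, as an `L`-module, by a single homogeneous element:
    (hgen : ∃ g : G, ∃ v ∈ V, v ∈ Γ.comp g ∧
      ∀ W : Submodule F M, W ≤ V.toSubmodule → v ∈ W →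
        (∀ x ∈ L, ∀ w ∈ W, ⁅x, w⁆ ∈ W) → V.toSubmodule ≤ W) :
    -- the support of `M` is commutative:
    ∀ g h : G, Γ.comp g ≠ ⊥ → Γ.comp h ≠ ⊥ → g * h = h * g := by
  obtain ⟨g₀, v, hvV, hvg, hmin⟩ := hgen
  set S : Set G := {g | L.toSubmodule ⊓ Γ.comp g ≠ ⊥}
  have hScomm : ∀ a ∈ S, ∀ b ∈ S, a * b = b * a := fun a ha b hb => hLsupp a b ha hb
  have hSH : ∀ g, L.toSubmodule ⊓ Γ.comp g ≠ ⊥ → g ∈ Subgroup.closure S :=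
    fun g hg => Subgroup.subset_closure hg
  have hVle : V.toSubmodule ≤
      ⨆ k ∈ Subgroup.closure S, V.toSubmodule ⊓ Γ.comp (k * g₀) :=
    hmin _ (iSup₂_le fun _ _ => inf_le_left)
      (Submodule.mem_iSup_of_mem 1 (Submodule.mem_iSup_of_mem (one_mem _)
        ⟨hvV, by rwa [one_mul]⟩))
      fun x hx w hw => Γ.lie_mem_iSup_coset hLgr hSH g₀ hx hw
  have hg₀ : ∀ g ∈ S, g * g₀ = g₀ * g := by
    intro g hg
    obtain ⟨x, hx, hx0⟩ := (Submodule.ne_bot_iff _).mp hg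
    by_contra hne
    refine hx0 (hfaith x hx.1 fun w hw => ?_)
    have hker : (⨆ k ∈ Subgroup.closure S, V.toSubmodule ⊓ Γ.comp (k * g₀)) ≤
        LinearMap.ker (LieAlgebra.ad F M x) := by
      refine iSup₂_le fun k hk y hy => ?_
      rw [LinearMap.mem_ker]
      change ⁅x, y⁆ = 0
      by_contra hxy
      have h1 := Γ.mul_comm_of_lie_ne_zero hx.2 hy.2 hxy
      have h2 := Subgroup.mul_comm_of_mem_closure hScomm (hSH g hg) hk
      rw [← mul_assoc, h2, mul_assoc, mul_assoc] at h1
      exact hne (mul_left_cancel h1)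
    exact LinearMap.mem_ker.mp (hker (hVle hw))
  have hTcomm : ∀ a ∈ insert g₀ S, ∀ b ∈ insert g₀ S, a * b = b * a := by
    rintro a (rfl | ha) b (rfl | hb)
    · rfl
    · exact (hg₀ b hb).symm
    · exact hg₀ a ha
    · exact hScomm a ha b hb
  have hspan : (⨆ g ∈ (Subgroup.closure (insert g₀ S) : Set G), Γ.comp g) = ⊤ := by
    rw [eq_top_iff, ← hsup]
    refine sup_le (hVle.trans ?_) ?_
    · refine iSup₂_le fun k hk => le_iSup₂_of_le (k * g₀) ?_ inf_le_right
      exact mul_mem (Subgroup.closure_mono (Set.subset_insert _ _) hk)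
        (Subgroup.subset_closure (Set.mem_insert _ _))
    · rw [hLgr]
      refine iSup_le fun g => ?_
      by_cases hg : L.toSubmodule ⊓ Γ.comp g = ⊥
      · simp [hg]
      · exact le_iSup₂_of_le g
          (Subgroup.subset_closure (Set.mem_insert_of_mem _ hg)) inf_le_right
  exact fun g h hg hh => Subgroup.mul_comm_of_mem_closure hTcomm
    (Γ.mem_of_comp_ne_bot hspan hg) (Γ.mem_of_comp_ne_bot hspan hh)
end

section
/- Let G be a group and let M be a G-graded Lie algebra over a field, V ⊆ M a graded ideal and L ⊆ M a graded subalgebra with M = V ⊕ L, where L = L_1 × ⋯ × L_k is a direct product of graded ideals L_i of L. Assume that V is graded-simple as an L-module under the adjoint action and that, for each i, the support of L_i is a commutative subset of G and V is faithful as an L_i-module. Then the support of M is a commutative subset of G. -/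
set_option synthInstance.maxHeartbeats 1000000
set_option maxHeartbeats 1000000

namespace LieGrading

variable {F : Type*} [Field F] {M : Type*} [LieRing M] [LieAlgebra F M]
    {G : Type*} [Group G] (Γ : LieGrading F M G)

theorem eq_of_mem_of_mem {g h : G} {x : M} (hg : x ∈ Γ.comp g) (hh : x ∈ Γ.comp h)
    (hx : x ≠ 0) : g = h := by
  by_contra hne
  exact hx (Submodule.disjoint_def.1 (Γ.indep g) x hg
    (Submodule.mem_iSup_of_mem h (Submodule.mem_iSup_of_mem (Ne.symm hne) hh)))

/-- If `W` has a nonzero homogeneous element of degree `g` and lies in the sum of the components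
of degrees in `T`, then `g ∈ T`. -/
theorem mem_of_le_iSup {g : G} {W : Submodule F M} (hW : W ⊓ Γ.comp g ≠ ⊥) {T : Set G}
    (hT : W ≤ ⨆ t ∈ T, Γ.comp t) : g ∈ T := by
  by_contra hg
  refine hW (disjoint_self.1 ((Γ.indep g).mono inf_le_right (inf_le_left.trans (hT.trans ?_))))
  refine iSup₂_le fun t ht => le_iSup₂_of_le t ?_ le_rfl
  rintro rfl
  exact hg ht

/-- The projections onto the homogeneous components. -/
theorem exists_proj : ∃ p : G → M →ₗ[F] M,
    (∀ g m, p g m ∈ Γ.comp g) ∧ (∀ g, ∀ m ∈ Γ.comp g, p g m = m) ∧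
    (∀ g h, g ≠ h → ∀ m ∈ Γ.comp h, p g m = 0) ∧
    (∀ m (W : Submodule F M), (∀ g, p g m ∈ W) → m ∈ W) := by
  classical
  have hint : DirectSum.IsInternal Γ.comp :=
    DirectSum.isInternal_submodule_of_iSupIndep_of_iSup_eq_top Γ.indep Γ.total
  let := hint.chooseDecomposition
  refine ⟨fun g => (Γ.comp g).subtype ∘ₗ DirectSum.component F G (fun g => Γ.comp g) g ∘ₗ
    (DirectSum.decomposeLinearEquiv Γ.comp).toLinearMap, ?_, ?_, ?_, ?_⟩
  · intro g m
    exact SetLike.coe_mem _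
  · intro g m hm
    exact DirectSum.decompose_of_mem_same Γ.comp hm
  · intro g h hgh m hm
    exact DirectSum.decompose_of_mem_ne Γ.comp hm hgh.symm
  · intro m W hW
    rw [← DirectSum.sum_support_decompose Γ.comp m]
    exact Submodule.sum_mem _ fun g _ => hW g

variable {Γ}

theorem IsGradedSubspace.induction {W : Submodule F M} (hW : Γ.IsGradedSubspace W)
    {N : Submodule F M} (h : ∀ g, ∀ w ∈ W, w ∈ Γ.comp g → w ∈ N) : W ≤ N := by
  rw [hW]
  exact iSup_le fun g w hw => h g w hw.1 hw.2

theorem isGradedSubspace_of_le {W : Submodule F M} (h : W ≤ ⨆ g : G, W ⊓ Γ.comp g) :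
    Γ.IsGradedSubspace W :=
  le_antisymm h (iSup_le fun _ => inf_le_left)

/-- The vectors of a graded subspace killed by a set of homogeneous elements form a
graded subspace. -/
theorem IsGradedSubspace.annihilator {V K : Submodule F M} (hV : Γ.IsGradedSubspace V)
    {Z : Set M} (hZ : ∀ z ∈ Z, ∃ g, z ∈ Γ.comp g)
    (hK : ∀ w, w ∈ K ↔ w ∈ V ∧ ∀ z ∈ Z, ⁅z, w⁆ = 0) : Γ.IsGradedSubspace K := by
  obtain ⟨p, hp, hps, hpn, hpm⟩ := Γ.exists_proj
  have hpV : ∀ g, V ≤ V.comap (p g) := by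
    intro g
    refine hV.induction fun h w hw hwh => ?_
    rw [Submodule.mem_comap]
    by_cases hgh : g = h
    · subst hgh
      rwa [hps g w hwh]
    · rw [hpn g h hgh w hwh]
      exact V.zero_mem
  have hlie : ∀ h, ∀ z ∈ Γ.comp h, ∀ g w, ⁅z, p g w⁆ = p (h * g) ⁅z, w⁆ := by
    intro h z hz g w
    have hw : w ∈ ⨆ g, Γ.comp g := Γ.total ▸ Submodule.mem_top
    induction hw using Submodule.iSup_induction' with
    | mem g' w hw =>
      by_cases hg : g = g'
      · subst hg
        rw [hps g w hw, hps _ _ (Γ.lie_mem h g z hz w hw)]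
      · rw [hpn g g' hg w hw, lie_zero,
          hpn (h * g) (h * g') (by simpa using hg) _ (Γ.lie_mem h g' z hz w hw)]
    | zero => simp
    | add x y _ _ hx hy => simp only [map_add, lie_add, hx, hy]
  refine isGradedSubspace_of_le fun w hw => hpm w _ fun g => ?_
  refine Submodule.mem_iSup_of_mem g ⟨(hK _).2 ⟨hpV g ((hK w).1 hw).1, fun z hz => ?_⟩, hp g w⟩
  obtain ⟨h, hzh⟩ := hZ z hz
  rw [hlie h z hzh, ((hK w).1 hw).2 z hz, map_zero]

end LieGrading

theorem stmt16 {F : Type*} [Field F] {M : Type*} [LieRing M] [LieAlgebra F M]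
    {G : Type*} [Group G] (Γ : LieGrading F M G)
    (V : LieIdeal F M) (L : LieSubalgebra F M)
    -- `M = V ⊕ L`:
    (hdisj : V.toSubmodule ⊓ L.toSubmodule = ⊥)
    (hsup : V.toSubmodule ⊔ L.toSubmodule = ⊤)
    -- `V` and `L` are graded:
    (hVgr : Γ.IsGradedSubspace V.toSubmodule)
    (hLgr : Γ.IsGradedSubspace L.toSubmodule)
    -- `L = L₁ × ⋯ × L_k` is a direct product of graded ideals `Lᵢ` of `L`:
    {k : ℕ} (Li : Fin k → Submodule F M)
    (hLi_le : ∀ i, Li i ≤ L.toSubmodule)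
    (hLi_ideal : ∀ i, ∀ x ∈ L, ∀ y ∈ Li i, ⁅x, y⁆ ∈ Li i)
    (hLi_gr : ∀ i, Γ.IsGradedSubspace (Li i))
    (hLi_indep : ∀ i : Fin k, Disjoint (Li i) (⨆ j : Fin k, ⨆ _ : j ≠ i, Li j))
    (hLi_sup : (⨆ i : Fin k, Li i) = L.toSubmodule)
    -- `V` is a graded-simple `L`-module (adjoint action):
    (hVne : V ≠ ⊥)
    (hVsimple : ∀ W : Submodule F M, W ≤ V.toSubmodule →
      (∀ x ∈ L, ∀ w ∈ W, ⁅x, w⁆ ∈ W) → Γ.IsGradedSubspace W →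
        W = ⊥ ∨ W = V.toSubmodule)
    -- the support of each `Lᵢ` is commutative:
    (hLisupp : ∀ i, ∀ g h : G, Li i ⊓ Γ.comp g ≠ ⊥ → Li i ⊓ Γ.comp h ≠ ⊥ → g * h = h * g)
    -- `V` is a faithful `Lᵢ`-module for each `i`:
    (hfaith : ∀ i, ∀ x ∈ Li i, (∀ v ∈ V, ⁅x, v⁆ = 0) → x = 0) :
    -- the support of `M` is commutative:
    ∀ g h : G, Γ.comp g ≠ ⊥ → Γ.comp h ≠ ⊥ → g * h = h * g := by
  have hfaith' : ∀ i, ∀ x ∈ Li i, x ≠ 0 → ∃ g, ∃ v ∈ V, v ∈ Γ.comp g ∧ ⁅x, v⁆ ≠ 0 := by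
    intro i x hx hx0
    by_contra! hcon
    refine hx0 (hfaith i x hx fun v hv => ?_)
    have : V.toSubmodule ≤ LinearMap.ker (LieAlgebra.ad F M x) :=
      hVgr.induction fun g w hw hwg => hcon g w hw hwg
    exact this hv
  have hstable : ∀ W : Submodule F M,
      (∀ i a, ∀ l ∈ Li i, l ∈ Γ.comp a → ∀ w ∈ W, ⁅l, w⁆ ∈ W) →
      ∀ l ∈ L, ∀ w ∈ W, ⁅l, w⁆ ∈ W := by
    intro W hW l hl w hw
    have hL : L.toSubmodule ≤ W.comap ((LieAlgebra.ad F M : M →ₗ[F] M →ₗ[F] M).flip w) := by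
      rw [← hLi_sup]
      exact iSup_le fun i => (hLi_gr i).induction fun a l hl hla => hW i a l hl hla w hw
    exact hL hl
  have hcomm : ∀ i j, i ≠ j → ∀ x ∈ Li i, ∀ y ∈ Li j, ⁅x, y⁆ = 0 := by
    intro i j hij x hx y hy
    have h1 : ⁅x, y⁆ ∈ Li i := by
      rw [← lie_skew]
      exact (Li i).neg_mem (hLi_ideal i y (hLi_le j hy) x hx)
    exact Submodule.disjoint_def.1 (hLi_indep i) _ h1 (Submodule.mem_iSup_of_mem j
      (Submodule.mem_iSup_of_mem hij.symm (hLi_ideal j x (hLi_le i hx) y hy)))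
  have hcommV : ∀ i j, i ≠ j → ∀ x ∈ Li i, ∀ y ∈ Li j, ∀ v : M, ⁅x, ⁅y, v⁆⁆ = ⁅y, ⁅x, v⁆⁆ := by
    intro i j hij x hx y hy v
    rw [leibniz_lie, hcomm i j hij x hx y hy, zero_lie, zero_add]
  have hVmem : ∀ x : M, ∀ v ∈ V, ⁅x, v⁆ ∈ V := fun x v hv => lie_mem_right F M V x v hv
  -- Nonzero homogeneous elements of distinct factors have a nonzero product on `V`.
  have hprod : ∀ i j, i ≠ j → ∀ a b, ∀ x ∈ Li i, x ∈ Γ.comp a → x ≠ 0 →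
      ∀ y ∈ Li j, y ∈ Γ.comp b → y ≠ 0 → ∃ v ∈ V, ⁅y, ⁅x, v⁆⁆ ≠ 0 := by
    intro i j hij a b x hx hxa hx0 y hy hyb hy0
    by_contra! hcon
    let Z : Set M := {z | z ∈ Li j ∧ (∃ g, z ∈ Γ.comp g) ∧ ∀ v ∈ V, ⁅z, ⁅x, v⁆⁆ = 0}
    let K : Submodule F M := V.toSubmodule ⊓
      ⨅ z ∈ Z, LinearMap.ker (LieAlgebra.ad F M z)
    have hK : ∀ w, w ∈ K ↔ w ∈ V.toSubmodule ∧ ∀ z ∈ Z, ⁅z, w⁆ = 0 := by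
      intro w
      simp only [K, Submodule.mem_inf, Submodule.mem_iInf, LinearMap.mem_ker]
      rfl
    have hKgr : Γ.IsGradedSubspace K := hVgr.annihilator (fun z hz => hz.2.1) hK
    have hKst : ∀ l ∈ L, ∀ w ∈ K, ⁅l, w⁆ ∈ K := by
      refine hstable K fun m c l hl hlc w hw => ?_
      obtain ⟨hwV, hwZ⟩ := (hK w).1 hw
      refine (hK _).2 ⟨hVmem l w hwV, fun z hz => ?_⟩
      by_cases hm : m = j
      · subst hm
        have hlz : ⁅l, z⁆ ∈ Z := by
          obtain ⟨hzj, ⟨d, hzd⟩, hzx⟩ := hz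
          refine ⟨hLi_ideal m l (hLi_le m hl) z hzj, ⟨c * d, Γ.lie_mem c d l hlc z hzd⟩,
            fun v hv => ?_⟩
          rw [lie_lie, hzx v hv, lie_zero, ← hcommV i m hij x hx l hl v,
            hzx _ (hVmem l v hv), sub_zero]
        have h := hwZ _ hlz
        rw [lie_lie, hwZ z hz, lie_zero, zero_sub, neg_eq_zero] at h
        exact h
      · rw [← hcommV m j hm l hl z hz.1, hwZ z hz, lie_zero]
    rcases hVsimple K inf_le_left hKst hKgr with h | h
    · refine hx0 (hfaith i x hx fun v hv => ?_)
      have : ⁅x, v⁆ ∈ K := (hK _).2 ⟨hVmem x v hv, fun z hz => hz.2.2 v hv⟩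
      rwa [h, Submodule.mem_bot] at this
    · refine hy0 (hfaith j y hy fun v hv => ?_)
      have hvK : v ∈ K := h ▸ hv
      exact ((hK v).1 hvK).2 y ⟨hy, ⟨b, hyb⟩, hcon⟩
  let S : Set G := {a | ∃ i, Li i ⊓ Γ.comp a ≠ ⊥}
  have hS : ∀ a ∈ S, ∀ b ∈ S, a * b = b * a := by
    rintro a ⟨i, hi⟩ b ⟨j, hj⟩
    by_cases hij : i = j
    · subst hij
      exact hLisupp i a b hi hj
    obtain ⟨x, ⟨hx, hxa⟩, hx0⟩ := Submodule.exists_mem_ne_zero_of_ne_bot hi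
    obtain ⟨y, ⟨hy, hyb⟩, hy0⟩ := Submodule.exists_mem_ne_zero_of_ne_bot hj
    obtain ⟨g, v, -, hvg, hv0⟩ : ∃ g, ∃ v ∈ V, v ∈ Γ.comp g ∧ ⁅y, ⁅x, v⁆⁆ ≠ 0 := by
      obtain ⟨v, hv, hv0⟩ := hprod i j hij a b x hx hxa hx0 y hy hyb hy0
      by_contra! hcon
      have : V.toSubmodule ≤ LinearMap.ker
          ((LieAlgebra.ad F M y) ∘ₗ (LieAlgebra.ad F M x)) :=
        hVgr.induction fun g w hw hwg => hcon g w hw hwg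
      exact hv0 (this hv)
    have h1 := Γ.lie_mem b _ y hyb _ (Γ.lie_mem a g x hxa v hvg)
    have h2 := Γ.lie_mem a _ x hxa _ (Γ.lie_mem b g y hyb v hvg)
    rw [hcommV i j hij x hx y hy v] at h2
    have h3 := Γ.eq_of_mem_of_mem h2 h1 hv0
    rw [← mul_assoc, ← mul_assoc] at h3
    exact mul_right_cancel h3
  have hA : ∀ c ∈ Subgroup.closure S, ∀ b : G, (∀ a ∈ S, a * b = b * a) → c * b = b * c := by
    intro c hc b hb
    have hle : Subgroup.closure S ≤ Subgroup.centralizer {b} :=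
      (Subgroup.closure_le _).2 fun a ha =>
        Subgroup.mem_centralizer_singleton_iff.2 (hb a ha)
    exact Subgroup.mem_centralizer_singleton_iff.1 (hle hc)
  -- The support of `V` lies in a single coset of the subgroup generated by the support of `L`.
  have hcoset : ∀ g h, V.toSubmodule ⊓ Γ.comp g ≠ ⊥ → V.toSubmodule ⊓ Γ.comp h ≠ ⊥ →
      ∃ c ∈ Subgroup.closure S, h = c * g := by
    intro g h hg hh
    let W : Submodule F M := ⨆ c ∈ Subgroup.closure S, V.toSubmodule ⊓ Γ.comp (c * g)
    have hle : ∀ c ∈ Subgroup.closure S, V.toSubmodule ⊓ Γ.comp (c * g) ≤ W :=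
      fun c hc => le_iSup₂_of_le c hc le_rfl
    have hWV : W ≤ V.toSubmodule := iSup₂_le fun _ _ => inf_le_left
    have hWgr : Γ.IsGradedSubspace W := LieGrading.isGradedSubspace_of_le <|
      iSup₂_le fun c hc => le_iSup_of_le (c * g) (le_inf (hle c hc) inf_le_right)
    have hWst : ∀ l ∈ L, ∀ w ∈ W, ⁅l, w⁆ ∈ W := by
      refine hstable W fun i a l hl hla w hw => ?_
      by_cases hl0 : l = 0
      · rw [hl0, zero_lie]
        exact W.zero_mem
      have ha : a ∈ S := ⟨i, (Submodule.ne_bot_iff _).2 ⟨l, ⟨hl, hla⟩, hl0⟩⟩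
      have hcomap : W ≤ W.comap (LieAlgebra.ad F M l) := by
        refine iSup₂_le fun c hc w hw => ?_
        refine hle (a * c) (Subgroup.mul_mem _ (Subgroup.subset_closure ha) hc)
          ⟨hVmem l w hw.1, ?_⟩
        rw [mul_assoc]
        exact Γ.lie_mem a _ l hla w hw.2
      exact hcomap hw
    have hW0 : W ≠ ⊥ := by
      intro h0
      have := hle 1 (Subgroup.one_mem _)
      rw [one_mul, h0, le_bot_iff] at this
      exact hg this
    have hWeq := (hVsimple W hWV hWst hWgr).resolve_left hW0
    have hmem : h ∈ {t | ∃ c ∈ Subgroup.closure S, t = c * g} :=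
      Γ.mem_of_le_iSup hh <| hWeq ▸ iSup₂_le fun c hc =>
        inf_le_right.trans (le_iSup₂_of_le (c * g) ⟨c, hc, rfl⟩ le_rfl)
    exact hmem
  have hSV : ∀ a ∈ S, ∀ g, V.toSubmodule ⊓ Γ.comp g ≠ ⊥ → a * g = g * a := by
    rintro a ⟨i, hi⟩ g hg
    obtain ⟨x, ⟨hx, hxa⟩, hx0⟩ := Submodule.exists_mem_ne_zero_of_ne_bot hi
    obtain ⟨h, v, hv, hvh, hv0⟩ := hfaith' i x hx hx0
    have hah : a * h = h * a := by
      refine Γ.eq_of_mem_of_mem (Γ.lie_mem a h x hxa v hvh) ?_ hv0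
      rw [← lie_skew]
      exact (Γ.comp _).neg_mem (Γ.lie_mem h a v hvh x hxa)
    have hh : V.toSubmodule ⊓ Γ.comp h ≠ ⊥ := by
      refine (Submodule.ne_bot_iff _).2 ⟨v, ⟨hv, hvh⟩, ?_⟩
      rintro rfl
      exact hv0 (lie_zero x)
    obtain ⟨c, hc, rfl⟩ := hcoset g h hg hh
    have hca := hA c hc a fun b hb => hS b hb a ⟨i, hi⟩
    rw [← mul_assoc, ← hca, mul_assoc, mul_assoc] at hah
    exact mul_left_cancel hah
  have hVV : ∀ g h, V.toSubmodule ⊓ Γ.comp g ≠ ⊥ → V.toSubmodule ⊓ Γ.comp h ≠ ⊥ →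
      g * h = h * g := by
    intro g h hg hh
    obtain ⟨c, hc, rfl⟩ := hcoset g h hg hh
    have hcg := hA c hc g fun a ha => hSV a ha g hg
    rw [← mul_assoc, ← hcg]
  have hsupp : ∀ g, Γ.comp g ≠ ⊥ → V.toSubmodule ⊓ Γ.comp g ≠ ⊥ ∨ g ∈ S := by
    intro g hg
    have hle : ∀ (W : Submodule F M) (h : G),
        (W ⊓ Γ.comp h ≠ ⊥ → V.toSubmodule ⊓ Γ.comp h ≠ ⊥ ∨ h ∈ S) →
        W ⊓ Γ.comp h ≤
          ⨆ t ∈ {t | V.toSubmodule ⊓ Γ.comp t ≠ ⊥ ∨ t ∈ S}, Γ.comp t := by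
      intro W h hW
      by_cases h0 : W ⊓ Γ.comp h = ⊥
      · rw [h0]
        exact bot_le
      · exact inf_le_right.trans (le_iSup₂_of_le h (hW h0) le_rfl)
    refine Γ.mem_of_le_iSup (W := ⊤) (T := {t | V.toSubmodule ⊓ Γ.comp t ≠ ⊥ ∨ t ∈ S})
      (by rwa [top_inf_eq]) ?_
    rw [← hsup, ← hLi_sup]
    refine sup_le (hVgr.induction fun h w hw hwh => ?_)
      (iSup_le fun i => (hLi_gr i).induction fun h w hw hwh => ?_)
    · exact hle _ h Or.inl ⟨hw, hwh⟩
    · exact hle (Li i) h (fun hne => Or.inr ⟨i, hne⟩) ⟨hw, hwh⟩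
  intro g h hg hh
  rcases hsupp g hg with hg | hg <;> rcases hsupp h hh with hh | hh
  · exact hVV g h hg hh
  · exact (hSV h hh g hg).symm
  · exact hSV g hg h hh
  · exact hS g hg h hh
end
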